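/- arXiv:1010.0152 — 2 statements merged into one kernel-verified Lean document; each statement's English description precedes it below -/
import Mathlib

section
/- Let k be a finite field with q elements of characteristic 2 and let m ≥ 1 be an integer. Then the set S of tuples (a₁, α₁, a₃, α₃, a₄, α₄, a₆, α₆) ∈ (k × k^m)⁴ for which there exist x, y ∈ k with y² + a₁·x·y + a₃·y = x³ + a₄·x + a₆, 2y + a₁·x + a₃ = 0, a₁·y = 3x² + a₄, and α₁_j·x·y + α₃_j·y = α₄_j·x + α₆_j for all j = 1,…,m, has exactly q^{3(m+1)} elements. Consequently the proportion of such 'singular jets' among all q^{4(m+1)} tuples is q^{-(m+1)}. -/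
noncomputable section

/-- The set of 'singular jets' `(a₁, α₁, a₃, α₃, a₄, α₄, a₆, α₆)` in characteristic 2:
the Weierstrass hypersurface `y² + a₁xy + a₃y = x³ + a₄x + a₆` is singular at a point
`(x,y)` in the fiber over a base point where each coefficient `a_i` has value `aᵢ` and
first-order partial derivatives `αᵢ`. -/
def SingJets2 (k : Type) [Field k] (m : ℕ) :
    Set ((k × (Fin m → k)) × (k × (Fin m → k)) × (k × (Fin m → k)) × (k × (Fin m → k))) :=
  {t | ∃ x y : k,
    y ^ 2 + t.1.1 * x * y + t.2.1.1 * y = x ^ 3 + t.2.2.1.1 * x + t.2.2.2.1 ∧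
    2 * y + t.1.1 * x + t.2.1.1 = 0 ∧
    t.1.1 * y = 3 * x ^ 2 + t.2.2.1.1 ∧
    ∀ j, t.1.2 j * x * y + t.2.1.2 j * y = t.2.2.1.2 j * x + t.2.2.2.2 j}

/-- The jet with prescribed value `a₁`, singular point `(x, y)` and derivatives `α₁`, `α₃`, `α₄`. -/
def singJet {k : Type} [Field k] {m : ℕ}
    (p : (k × k × k) × ((Fin m → k) × (Fin m → k) × (Fin m → k))) :
    (k × (Fin m → k)) × (k × (Fin m → k)) × (k × (Fin m → k)) × (k × (Fin m → k)) :=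
  let a := p.1.1
  let x := p.1.2.1
  let y := p.1.2.2
  ((a, p.2.1), (a * x, p.2.2.1), (a * y + x ^ 2, p.2.2.2),
    (y ^ 2 + a * x * y, fun j => p.2.1 j * x * y + p.2.2.1 j * y + p.2.2.2 j * x))

theorem range_singJet (k : Type) [Field k] [CharP k 2] (m : ℕ) :
    Set.range (singJet (k := k) (m := m)) = SingJets2 k m := by
  have h2 : (2 : k) = 0 := CharTwo.two_eq_zero
  ext ⟨⟨a₁, α₁⟩, ⟨a₃, α₃⟩, ⟨a₄, α₄⟩, ⟨a₆, α₆⟩⟩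
  simp only [SingJets2, singJet, Set.mem_range, Set.mem_ofPred_eq, Prod.mk.injEq, Prod.exists]
  constructor
  · rintro ⟨a, x, y, β₁, β₃, β₄, ⟨rfl, rfl⟩, ⟨rfl, rfl⟩, ⟨rfl, rfl⟩, rfl, rfl⟩
    refine ⟨x, y, ?_, ?_, ?_, fun j => ?_⟩
    · linear_combination (-x ^ 3) * h2
    · linear_combination (y + a * x) * h2
    · linear_combination (-2 * x ^ 2) * h2
    · linear_combination (-(β₄ j * x)) * h2
  · rintro ⟨x, y, h₁, h₃, h₄, h₆⟩
    have e₃ : a₁ * x = a₃ := by linear_combination h₃ - (y + a₃) * h2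
    have e₄ : a₁ * y + x ^ 2 = a₄ := by linear_combination h₄ + 2 * x ^ 2 * h2
    refine ⟨a₁, x, y, α₁, α₃, α₄, ⟨rfl, rfl⟩, ⟨e₃, rfl⟩, ⟨e₄, rfl⟩, ?_, funext fun j => ?_⟩
    · linear_combination h₁ + e₃ * y - e₄ * x + x ^ 3 * h2
    · linear_combination h₆ j + α₄ j * x * h2

theorem singJet_injective (k : Type) [Field k] [CharP k 2] (m : ℕ) :
    Function.Injective (singJet (k := k) (m := m)) := by
  rintro ⟨⟨a, x, y⟩, β₁, β₃, β₄⟩ ⟨⟨b, u, v⟩, γ₁, γ₃, γ₄⟩ h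
  simp only [singJet, Prod.mk.injEq] at h
  obtain ⟨⟨rfl, rfl⟩, ⟨h₃, rfl⟩, ⟨h₄, rfl⟩, h₆, -⟩ := h
  obtain ⟨rfl, rfl⟩ : x = u ∧ y = v := by
    rcases eq_or_ne a 0 with rfl | ha
    · simp only [zero_mul, zero_add, add_zero] at h₄ h₆
      exact ⟨CharTwo.sq_injective h₄, CharTwo.sq_injective h₆⟩
    · obtain rfl := mul_left_cancel₀ ha h₃
      exact ⟨rfl, mul_left_cancel₀ ha (add_right_cancel h₄)⟩
  rfl

theorem card_singJets2 (k : Type) [Field k] [Fintype k] [CharP k 2] (m : ℕ) :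
    Nat.card (SingJets2 k m) = Fintype.card k ^ (3 * (m + 1)) := by
  rw [← range_singJet, Nat.card_range_of_injective (singJet_injective k m)]
  simp only [Nat.card_eq_fintype_card, Fintype.card_prod, Fintype.card_pi_const]
  ring

/-- over a finite field of characteristic `2` with `q` elements,
the set of singular jets has exactly `q^(3(m+1))` elements; consequently its
proportion among all `q^(4(m+1))` jets is `q^(-(m+1))`. -/
theorem stmt6 (k : Type) [Field k] [Fintype k] [CharP k 2] (m : ℕ) (hm : 1 ≤ m) :
    Nat.card (SingJets2 k m) = Fintype.card k ^ (3 * (m + 1)) ∧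
    (Nat.card (SingJets2 k m) : ℝ) / (Fintype.card k : ℝ) ^ (4 * (m + 1)) =
      ((Fintype.card k : ℝ) ^ (m + 1))⁻¹ := by
  have hq : (Fintype.card k : ℝ) ≠ 0 := Nat.cast_ne_zero.mpr Fintype.card_ne_zero
  refine ⟨card_singJets2 k m, ?_⟩
  rw [card_singJets2, Nat.cast_pow, div_eq_iff (pow_ne_zero _ hq),
    eq_inv_mul_iff_mul_eq₀ (pow_ne_zero _ hq), ← pow_add]
  congr 1
  ring
end
end

section
/- Let q be a power of a prime p > 3 and let m ≥ 1. Set ν = (q^{m+1} − 1)/(q − 1) = #ℙ^m(𝔽_q). Then the limit as k → ∞ of the fraction of Weierstrass pairs (A,B) of level k such that W_{A,B} is singular over no 𝔽_q-rational point P ∈ ℙ^m(𝔽_q) exists and equals (1 − q^{-(m+1)})^ν = ∏_{P ∈ ℙ^m(𝔽_q)} (1 − q^{-(m+1)}). -/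
open MvPolynomial Filter

noncomputable section

variable (F : Type) [Field F] [Fintype F]

/-- The set of Weierstrass pairs `(A,B)` of level `k`: `A` homogeneous of degree `4k`
and `B` homogeneous of degree `6k`. -/
def WPairs (m k : ℕ) : Set (MvPolynomial (Fin (m + 1)) F × MvPolynomial (Fin (m + 1)) F) :=
  {AB | AB.1.IsHomogeneous (4 * k) ∧ AB.2.IsHomogeneous (6 * k)}

/-- The Weierstrass model `W_{A,B}` is singular at a point lying over the point of
`ℙ^m(𝔽̄_q)` with homogeneous coordinates `pt`. -/
def SingAt (m : ℕ) (A B : MvPolynomial (Fin (m + 1)) F)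
    (pt : Fin (m + 1) → AlgebraicClosure F) : Prop :=
  ∃ x y : AlgebraicClosure F,
    y ^ 2 = x ^ 3 + aeval pt A * x + aeval pt B ∧
    2 * y = 0 ∧
    3 * x ^ 2 + aeval pt A = 0 ∧
    ∀ i, aeval pt (pderiv i A) * x + aeval pt (pderiv i B) = 0

section Jets

variable {K σ : Type*} [Field K]

lemma MvPolynomial.IsHomogeneous.aeval_smul {L : Type*} [Field L] [Algebra K L]
    {φ : MvPolynomial σ K} {n : ℕ} (h : φ.IsHomogeneous n) (a : L) (x : σ → L) :
    MvPolynomial.aeval (a • x) φ = a ^ n * MvPolynomial.aeval x φ := by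
  simp only [MvPolynomial.aeval_def, MvPolynomial.eval₂_eq, Finset.mul_sum]
  refine Finset.sum_congr rfl fun d hd => ?_
  have hdeg := h.degree_eq_sum_deg_support hd
  simp only [Pi.smul_apply, smul_eq_mul, mul_pow, Finset.prod_mul_distrib, Finset.prod_pow_eq_pow_sum]
  rw [show ∑ i ∈ d.support, d i = n from hdeg.symm]
  ring

open LinearAlgebra.Projectivization in
lemma exists_linear_separating {P Q : ℙ K (σ → K)} (h : Q ≠ P) :
    ∃ ℓ : MvPolynomial σ K, ℓ.IsHomogeneous 1 ∧ eval Q.rep ℓ = 0 ∧ eval P.rep ℓ ≠ 0 := by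
  by_contra! H
  obtain ⟨i, hi⟩ := Function.ne_iff.mp Q.rep_nonzero
  refine h ?_
  rw [← Q.mk_rep, ← P.mk_rep, Projectivization.mk_eq_mk_iff']
  have key : ∀ j, Q.rep i * P.rep j - Q.rep j * P.rep i = 0 := fun j => by
    simpa using H (C (Q.rep i) * X j - C (Q.rep j) * X i)
      ((isHomogeneous_C_mul_X _ _).sub (isHomogeneous_C_mul_X _ _)) (by simp; ring)
  have hP : P.rep i ≠ 0 := fun h0 => P.rep_nonzero <| by
    ext j
    have := key j
    rw [h0, mul_zero, sub_zero] at this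
    exact (mul_eq_zero.mp this).resolve_left hi
  refine ⟨Q.rep i / P.rep i, ?_⟩
  ext j
  simp only [Pi.smul_apply, smul_eq_mul]
  field_simp
  linear_combination key j

open LinearAlgebra.Projectivization in
/-- A coordinate that does not vanish at `P`. -/
def chart (P : ℙ K (σ → K)) : σ := (Function.ne_iff.mp P.rep_nonzero).choose

open LinearAlgebra.Projectivization in
lemma rep_chart_ne_zero (P : ℙ K (σ → K)) : P.rep (chart P) ≠ 0 :=
  (Function.ne_iff.mp P.rep_nonzero).choose_spec

/-- The 1-jet of a homogeneous polynomial at the point with homogeneous coordinates `x`,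
in the affine chart where the `i`-th coordinate does not vanish: the value is stored in
position `i`, the other partial derivatives in the remaining positions. -/
def jet [DecidableEq σ] (i : σ) (x : σ → K) : MvPolynomial σ K →ₗ[K] σ → K :=
  LinearMap.pi fun j =>
    if j = i then (aeval x).toLinearMap
    else (aeval x).toLinearMap ∘ₗ (pderiv j : Derivation K _ _).toLinearMap

variable [DecidableEq σ]

lemma jet_self (i : σ) (x : σ → K) (φ : MvPolynomial σ K) : jet i x φ i = eval x φ := by
  simp [jet]

lemma jet_of_ne {i j : σ} (h : j ≠ i) (x : σ → K) (φ : MvPolynomial σ K) :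
    jet i x φ j = eval x (pderiv j φ) := by
  simp [jet, h]

lemma jet_mul_eq_zero (i : σ) (x : σ → K) {φ : MvPolynomial σ K} (ψ : MvPolynomial σ K)
    (h : jet i x φ = 0) : jet i x (φ * ψ) = 0 := by
  have h0 : eval x φ = 0 := by rw [← jet_self i, h]; rfl
  ext j
  rcases eq_or_ne j i with rfl | hj
  · simp [jet_self, h0]
  · have h1 : eval x (pderiv j φ) = 0 := by rw [← jet_of_ne hj, h]; rfl
    simp [jet_of_ne hj, h0, h1]

lemma jet_sq_eq_zero (i : σ) (x : σ → K) {φ : MvPolynomial σ K} (h : eval x φ = 0) :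
    jet i x (φ ^ 2) = 0 := by
  ext j
  rcases eq_or_ne j i with rfl | hj
  · simp [jet_self, h]
  · simp [jet_of_ne hj, h]

/-- Multiples of a form not vanishing at `x` by linear forms realise every jet at `x`. -/
lemma exists_linear_jet_mul [Fintype σ] {i : σ} {x : σ → K} (hx : x i ≠ 0)
    {φ : MvPolynomial σ K} (hφ : eval x φ ≠ 0) (v : σ → K) :
    ∃ ℓ : MvPolynomial σ K, ℓ.IsHomogeneous 1 ∧ jet i x (φ * ℓ) = v := by
  set c := eval x φ with hc
  let w : σ → K := fun j => (v j - v i / c * eval x (pderiv j φ)) / c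
  let u : σ → K := Function.update w i
    ((v i / c - ∑ j ∈ Finset.univ.erase i, w j * x j) / x i)
  let ℓ : MvPolynomial σ K := ∑ j, C (u j) * X j
  have hval : eval x ℓ = v i / c := by
    simp only [ℓ, map_sum, map_mul, eval_X, eval_C]
    rw [← Finset.add_sum_erase _ _ (Finset.mem_univ i)]
    rw [Finset.sum_congr rfl (g := fun j => w j * x j) fun j hj => by
      simp [u, Finset.ne_of_mem_erase hj]]
    simp only [u, Function.update_self]
    field_simp
    ring
  have hder : ∀ j, pderiv j ℓ = C (u j) := fun j => by
    simp [ℓ, pderiv_X, Pi.single_apply]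
  refine ⟨ℓ, IsHomogeneous.sum _ _ _ fun j _ => isHomogeneous_C_mul_X _ _, ?_⟩
  ext j
  rcases eq_or_ne j i with rfl | hj
  · rw [jet_self, map_mul, hval, ← hc]
    field_simp
  · rw [jet_of_ne hj, Derivation.leibniz, hder]
    simp only [smul_eq_mul, map_add, map_mul, hval, ← hc, eval_C, u, Function.update_of_ne hj, w]
    field_simp
    ring


open LinearAlgebra.Projectivization in
lemma exists_jet_eq_of_ne [Fintype σ] [Fintype (ℙ K (σ → K))] {d : ℕ}
    (hd : 2 * Fintype.card (ℙ K (σ → K)) + 1 ≤ d) (P : ℙ K (σ → K)) (v : σ → K) :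
    ∃ φ : MvPolynomial σ K, φ.IsHomogeneous d ∧ jet (chart P) P.rep φ = v ∧
      ∀ Q ≠ P, jet (chart Q) Q.rep φ = 0 := by
  classical
  choose! ℓ hℓ hℓQ hℓP using fun Q : ℙ K (σ → K) => exists_linear_separating (P := P) (Q := Q)
  set s := Finset.univ.erase P
  have hs : ∑ Q ∈ s, 1 * 2 ≤ 2 * Fintype.card (ℙ K (σ → K)) := by
    rw [Finset.sum_const, smul_eq_mul, mul_comm]
    exact Nat.mul_le_mul_left _ (Finset.card_le_univ s)
  set e := d - 1 - ∑ Q ∈ s, 1 * 2 with he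
  let H : MvPolynomial σ K := (∏ Q ∈ s, ℓ Q ^ 2) * X (chart P) ^ e
  have hH : H.IsHomogeneous (∑ Q ∈ s, 1 * 2 + e) :=
    (IsHomogeneous.prod _ _ _ fun Q hQ => (hℓ Q (Finset.ne_of_mem_erase hQ)).pow 2).mul
      (isHomogeneous_X_pow _ _)
  have hHP : eval P.rep H ≠ 0 := by
    simp only [H, map_mul, map_prod, map_pow, eval_X]
    exact mul_ne_zero (Finset.prod_ne_zero_iff.mpr fun Q hQ =>
      pow_ne_zero _ (hℓP Q (Finset.ne_of_mem_erase hQ))) (pow_ne_zero _ (rep_chart_ne_zero P))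
  obtain ⟨μ, hμ, hjet⟩ := exists_linear_jet_mul (rep_chart_ne_zero P) hHP v
  refine ⟨H * μ, ?_, hjet, fun Q hQ => ?_⟩
  · have := hH.mul hμ
    rwa [show ∑ Q ∈ s, 1 * 2 + e + 1 = d by omega] at this
  · have hQs : Q ∈ s := Finset.mem_erase.mpr ⟨hQ, Finset.mem_univ _⟩
    simp only [H]
    rw [← Finset.mul_prod_erase _ _ hQs, mul_assoc, mul_assoc]
    exact jet_mul_eq_zero _ _ _ (jet_sq_eq_zero _ _ (hℓQ Q hQ))

open LinearAlgebra.Projectivization in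
/-- In large degree, jets can be prescribed independently at all rational points. -/
lemma exists_jet_eq [Fintype σ] [Fintype (ℙ K (σ → K))] {d : ℕ}
    (hd : 2 * Fintype.card (ℙ K (σ → K)) + 1 ≤ d) (v : ℙ K (σ → K) → σ → K) :
    ∃ φ : MvPolynomial σ K, φ.IsHomogeneous d ∧ ∀ P, jet (chart P) P.rep φ = v P := by
  choose φ hφ hφP hφQ using fun P => exists_jet_eq_of_ne hd P (v P)
  refine ⟨∑ P, φ P, IsHomogeneous.sum _ _ _ fun P _ => hφ P, fun P => ?_⟩
  rw [map_sum, Finset.sum_eq_single P (fun Q _ hQ => hφQ Q P hQ.symm) (by simp), hφP]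

/-- Pairs of jets, in the `i`-th chart, of the coefficients of a Weierstrass model having a
singular point `(t, 0)` in the fibre. -/
def singularJets (i : σ) : Set ((σ → K) × (σ → K)) :=
  {uv | ∃ t : K, uv.1 i = -3 * t ^ 2 ∧ uv.2 i = 2 * t ^ 3 ∧ ∀ j ≠ i, uv.1 j * t + uv.2 j = 0}

omit [DecidableEq σ] in
lemma card_singularJets (h2 : (2 : K) ≠ 0) (h3 : (3 : K) ≠ 0) (i : σ) :
    Nat.card (singularJets (K := K) i) = Nat.card (σ → K) := by
  classical
  let g : (σ → K) → (σ → K) × (σ → K) := fun w =>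
    (Function.update w i (-3 * w i ^ 2),
      Function.update (fun j => -(w j * w i)) i (2 * w i ^ 3))
  have hg : Function.Injective g := by
    intro w w' h
    obtain ⟨h₁, h₂⟩ := Prod.ext_iff.mp h
    have hsq : w i ^ 2 = w' i ^ 2 := by
      have := congrFun h₁ i
      simp only [g, Function.update_self] at this
      exact mul_left_cancel₀ (neg_ne_zero.mpr h3) this
    have hcu : w i ^ 3 = w' i ^ 3 := by
      have := congrFun h₂ i
      simp only [g, Function.update_self] at this
      exact mul_left_cancel₀ h2 this
    ext j
    rcases eq_or_ne j i with rfl | hj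
    · by_cases h0 : w j = 0
      · rw [h0] at hsq ⊢
        exact (pow_eq_zero_iff two_ne_zero).mp (by rw [← hsq]; ring) |>.symm
      · refine mul_left_cancel₀ (pow_ne_zero 2 h0) ?_
        linear_combination hcu - w' j * hsq
    · simpa [g, hj] using congrFun h₁ j
  have hrange : singularJets i = Set.range g := by
    ext ⟨u, v⟩
    constructor
    · rintro ⟨t, hu, hv, h⟩
      refine ⟨Function.update u i t, Prod.ext ?_ ?_⟩
      · ext j
        rcases eq_or_ne j i with rfl | hj
        · simpa [g] using hu.symm
        · simp [g, hj]
      · ext j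
        rcases eq_or_ne j i with rfl | hj
        · simpa [g] using hv.symm
        · simp only [g, Function.update_self, Function.update_of_ne hj]
          linear_combination -h j hj
    · rintro ⟨w, hw⟩
      rw [← hw]
      refine ⟨w i, by simp [g], by simp [g], fun j hj => ?_⟩
      simp [g, hj]
  rw [hrange]
  exact (Nat.card_congr (Equiv.ofInjective g hg)).symm

end Jets

section Singularity

variable {F} {m k : ℕ} {A B : MvPolynomial (Fin (m + 1)) F}

omit [Fintype F] in
lemma singAt_iff_jet_mem (h2 : (2 : F) ≠ 0) (h3 : (3 : F) ≠ 0)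
    (hA : A.IsHomogeneous (4 * k)) (hB : B.IsHomogeneous (6 * k))
    {pt : Fin (m + 1) → F} {i : Fin (m + 1)} (hi : pt i ≠ 0) :
    SingAt F m A B (fun j => algebraMap F (AlgebraicClosure F) (pt j)) ↔
      (jet i pt A, jet i pt B) ∈ singularJets i := by
  set ι := algebraMap F (AlgebraicClosure F)
  have hι : Function.Injective ι := ι.injective
  have hev : ∀ φ : MvPolynomial (Fin (m + 1)) F,
      aeval (fun j => ι (pt j)) φ = ι (eval pt φ) := fun φ => by
    rw [← coe_aeval_eq_eval]
    exact aeval_algebraMap_apply (AlgebraicClosure F) pt φ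
  have h2' : (2 : AlgebraicClosure F) ≠ 0 := by
    rw [← map_ofNat ι 2]; exact (map_ne_zero ι).mpr h2
  have h3' : (3 : AlgebraicClosure F) ≠ 0 := by
    rw [← map_ofNat ι 3]; exact (map_ne_zero ι).mpr h3
  simp only [SingAt, singularJets, hev, Set.mem_ofPred_eq, jet_self]
  constructor
  · rintro ⟨x, y, hxy, hy, hx, hd⟩
    have hy0 : y = 0 := (mul_eq_zero.mp hy).resolve_left h2'
    subst hy0
    obtain ⟨t, rfl⟩ : ∃ t, ι t = x := by
      by_cases ha : eval pt A = 0
      · rw [ha, map_zero, add_zero] at hx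
        have hx0 : x = 0 :=
          (pow_eq_zero_iff two_ne_zero).mp ((mul_eq_zero.mp hx).resolve_left h3')
        exact ⟨0, by rw [hx0, map_zero]⟩
      · have ha' : ι (eval pt A) ≠ 0 := (map_ne_zero ι).mpr ha
        refine ⟨-3 * eval pt B / (2 * eval pt A), ?_⟩
        simp only [map_div₀, map_mul, map_neg, map_ofNat]
        rw [div_eq_iff (mul_ne_zero h2' ha')]
        linear_combination 3 * hxy + x * hx
    refine ⟨t, hι ?_, hι ?_, fun j hj => hι ?_⟩
    · simp only [map_mul, map_neg, map_ofNat, map_pow]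
      linear_combination hx
    · simp only [map_mul, map_ofNat, map_pow]
      linear_combination -hxy - ι t * hx
    · simpa [jet_of_ne hj] using hd j
  · rintro ⟨t, ha, hb, hd⟩
    have hd' : ∀ j ≠ i, eval pt (pderiv j A) * t + eval pt (pderiv j B) = 0 := fun j hj => by
      simpa [jet_of_ne hj] using hd j hj
    have hdi : eval pt (pderiv i A) * t + eval pt (pderiv i B) = 0 := by
      have hEA := congrArg (eval pt) hA.sum_X_mul_pderiv
      have hEB := congrArg (eval pt) hB.sum_X_mul_pderiv
      simp only [map_sum, map_mul, eval_X, nsmul_eq_mul, map_natCast, ha, hb] at hEA hEB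
      have hsum : ∑ j, pt j * (eval pt (pderiv j A) * t + eval pt (pderiv j B)) =
          pt i * (eval pt (pderiv i A) * t + eval pt (pderiv i B)) :=
        Finset.sum_eq_single i (fun j _ hj => by rw [hd' j hj, mul_zero]) (by simp)
      have hsplit : ∑ j, pt j * (eval pt (pderiv j A) * t + eval pt (pderiv j B)) =
          (∑ j, pt j * eval pt (pderiv j A)) * t + ∑ j, pt j * eval pt (pderiv j B) := by
        rw [Finset.sum_mul, ← Finset.sum_add_distrib]
        exact Finset.sum_congr rfl fun j _ => by ring
      refine (mul_eq_zero.mp ?_).resolve_left hi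
      rw [← hsum, hsplit, hEA, hEB]
      push_cast
      ring
    refine ⟨ι t, 0, ?_, mul_zero _, ?_, fun j => ?_⟩
    · rw [ha, hb]
      simp only [map_mul, map_neg, map_ofNat, map_pow]
      ring
    · rw [ha]
      simp only [map_mul, map_neg, map_ofNat, map_pow]
      ring
    · rw [← map_mul, ← map_add, ← map_zero ι]
      rcases eq_or_ne j i with rfl | hj
      · rw [hdi]
      · rw [hd' j hj]

omit [Fintype F] in
lemma SingAt.smul (hk : 1 ≤ k) (hA : A.IsHomogeneous (4 * k)) (hB : B.IsHomogeneous (6 * k))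
    {x : Fin (m + 1) → AlgebraicClosure F} (h : SingAt F m A B x) (a : AlgebraicClosure F) :
    SingAt F m A B (a • x) := by
  obtain ⟨x, y, hxy, hy, hx, hd⟩ := h
  refine ⟨a ^ (2 * k) * x, a ^ (3 * k) * y, ?_, ?_, ?_, fun i => ?_⟩
  · rw [hA.aeval_smul, hB.aeval_smul]
    linear_combination a ^ (6 * k) * hxy
  · linear_combination a ^ (3 * k) * hy
  · rw [hA.aeval_smul]
    linear_combination a ^ (4 * k) * hx
  · rw [hA.pderiv.aeval_smul, hB.pderiv.aeval_smul,
      show 6 * k - 1 = (4 * k - 1) + 2 * k by omega, pow_add]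
    linear_combination a ^ (4 * k - 1) * a ^ (2 * k) * hd i

open LinearAlgebra.Projectivization in
omit [Fintype F] in
lemma forall_not_singAt_iff (hk : 1 ≤ k) (h2 : (2 : F) ≠ 0) (h3 : (3 : F) ≠ 0)
    (hA : A.IsHomogeneous (4 * k)) (hB : B.IsHomogeneous (6 * k)) :
    (∀ pt : Fin (m + 1) → F, pt ≠ 0 →
        ¬ SingAt F m A B fun i => algebraMap F (AlgebraicClosure F) (pt i)) ↔
      ∀ P : ℙ F (Fin (m + 1) → F),
        (jet (chart P) P.rep A, jet (chart P) P.rep B) ∉ singularJets (chart P) := by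
  simp only [← singAt_iff_jet_mem h2 h3 hA hB (rep_chart_ne_zero _)]
  refine ⟨fun h P => h _ P.rep_nonzero, fun h pt hpt hs => ?_⟩
  obtain ⟨a, ha⟩ := Projectivization.exists_smul_eq_mk_rep F pt hpt
  refine h (Projectivization.mk F pt hpt) ?_
  convert hs.smul hk hA hB (algebraMap F (AlgebraicClosure F) a) using 1
  ext i
  simp [← ha, Units.smul_def]

end Singularity

lemma AddMonoidHom.card_preimage_of_surjective {V W : Type*} [AddGroup V] [AddGroup W]
    {f : V →+ W} (hf : Function.Surjective f) (S : Set W) :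
    Nat.card (f ⁻¹' S) = Nat.card S * Nat.card f.ker := by
  choose g hg using hf
  rw [← Nat.card_prod]
  refine Nat.card_congr
    { toFun v := (⟨f v, v.2⟩, ⟨-g (f v) + v, by simp [AddMonoidHom.mem_ker, hg]⟩)
      invFun w := ⟨g w.1 + w.2, by
        have := AddMonoidHom.mem_ker.mp w.2.2
        simp [hg, this]⟩
      left_inv v := by simp
      right_inv w := by
        have := AddMonoidHom.mem_ker.mp w.2.2
        ext <;> simp [hg, this] }

section Counting

open LinearAlgebra.Projectivization

/-- The jets of a Weierstrass pair at all rational points of projective space. -/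
def jetsHom (m k : ℕ) :
    homogeneousSubmodule (Fin (m + 1)) F (4 * k) × homogeneousSubmodule (Fin (m + 1)) F (6 * k) →+
      (ℙ F (Fin (m + 1) → F) → (Fin (m + 1) → F) × (Fin (m + 1) → F)) where
  toFun AB P := (jet (chart P) P.rep AB.1.1, jet (chart P) P.rep AB.2.1)
  map_zero' := by ext <;> simp
  map_add' _ _ := by ext <;> simp

variable {F}

lemma jetsHom_surjective {m k : ℕ} (hk : 2 * Nat.card (ℙ F (Fin (m + 1) → F)) + 1 ≤ k) :
    Function.Surjective (jetsHom F m k) := by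
  intro v
  have := Fintype.ofFinite (ℙ F (Fin (m + 1) → F))
  rw [Nat.card_eq_fintype_card] at hk
  obtain ⟨A, hA, hAv⟩ := exists_jet_eq (d := 4 * k) (by omega) fun P => (v P).1
  obtain ⟨B, hB, hBv⟩ := exists_jet_eq (d := 6 * k) (by omega) fun P => (v P).2
  exact ⟨(⟨A, hA⟩, ⟨B, hB⟩), funext fun P => Prod.ext (hAv P) (hBv P)⟩

omit [Fintype F] in
lemma card_image_subtype_val (m k : ℕ)
    (S : Set (homogeneousSubmodule (Fin (m + 1)) F (4 * k) ×
      homogeneousSubmodule (Fin (m + 1)) F (6 * k))) :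
    Nat.card (Prod.map Subtype.val Subtype.val '' S) = Nat.card S :=
  Nat.card_image_of_injective (Subtype.val_injective.prodMap Subtype.val_injective) S

lemma card_WPairs {m k : ℕ} (hk : 2 * Nat.card (ℙ F (Fin (m + 1) → F)) + 1 ≤ k) :
    Nat.card (WPairs F m k) =
      (Nat.card (Fin (m + 1) → F) * Nat.card (Fin (m + 1) → F)) ^
        Nat.card (ℙ F (Fin (m + 1) → F)) * Nat.card (jetsHom F m k).ker := by
  have hW : WPairs F m k = Prod.map Subtype.val Subtype.val '' (jetsHom F m k ⁻¹' Set.univ) := by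
    ext ⟨A, B⟩
    simp [WPairs]
  rw [hW, card_image_subtype_val,
    AddMonoidHom.card_preimage_of_surjective (jetsHom_surjective hk), Nat.card_univ,
    Nat.card_fun, Nat.card_prod]

lemma card_smooth_WPairs (h2 : (2 : F) ≠ 0) (h3 : (3 : F) ≠ 0) {m k : ℕ}
    (hk : 2 * Nat.card (ℙ F (Fin (m + 1) → F)) + 1 ≤ k) :
    Nat.card {AB ∈ WPairs F m k | ∀ pt : Fin (m + 1) → F, pt ≠ 0 →
        ¬ SingAt F m AB.1 AB.2 fun i => algebraMap F (AlgebraicClosure F) (pt i)} =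
      (Nat.card (Fin (m + 1) → F) * Nat.card (Fin (m + 1) → F) - Nat.card (Fin (m + 1) → F)) ^
        Nat.card (ℙ F (Fin (m + 1) → F)) * Nat.card (jetsHom F m k).ker := by
  have hW : {AB ∈ WPairs F m k | ∀ pt : Fin (m + 1) → F, pt ≠ 0 →
        ¬ SingAt F m AB.1 AB.2 fun i => algebraMap F (AlgebraicClosure F) (pt i)} =
      Prod.map Subtype.val Subtype.val '' (jetsHom F m k ⁻¹'
        Set.univ.pi fun P => (singularJets (chart P))ᶜ) := by
    ext AB
    constructor
    · rintro ⟨⟨hA, hB⟩, h⟩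
      rw [forall_not_singAt_iff (by omega) h2 h3 hA hB] at h
      exact ⟨(⟨AB.1, hA⟩, ⟨AB.2, hB⟩), fun P _ => h P, rfl⟩
    · rintro ⟨⟨⟨A, hA⟩, ⟨B, hB⟩⟩, h, rfl⟩
      exact ⟨⟨hA, hB⟩, (forall_not_singAt_iff (by omega) h2 h3 hA hB).mpr
        fun P => h P (Set.mem_univ P)⟩
  have hcompl (P : ℙ F (Fin (m + 1) → F)) :
      Nat.card ((singularJets (K := F) (chart P))ᶜ : Set _) =
        Nat.card (Fin (m + 1) → F) * Nat.card (Fin (m + 1) → F) - Nat.card (Fin (m + 1) → F) := by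
    rw [Nat.card_coe_set_eq, Set.ncard_compl, Nat.card_prod, ← Nat.card_coe_set_eq,
      card_singularJets h2 h3]
  have := Fintype.ofFinite (ℙ F (Fin (m + 1) → F))
  rw [hW, card_image_subtype_val,
    AddMonoidHom.card_preimage_of_surjective (jetsHom_surjective hk),
    Nat.card_congr (Equiv.Set.univPi _), Nat.card_pi, Finset.prod_congr rfl fun P _ => hcompl P,
    Finset.prod_const, Finset.card_univ, Nat.card_eq_fintype_card (α := ℙ F _)]

end Counting

/-- the fraction of Weierstrass pairs of level `k` whose model is
singular over no `𝔽_q`-rational point of `ℙ^m` tends, as `k → ∞`, to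
`(1 − q^{-(m+1)})^ν` where `ν = (q^{m+1} − 1)/(q − 1) = #ℙ^m(𝔽_q)`. -/
theorem stmt9 (p : ℕ) (hp : p.Prime) (hp3 : 3 < p) [CharP F p] (m : ℕ) (hm : 1 ≤ m) :
    Tendsto (fun k : ℕ =>
        (Nat.card {AB ∈ WPairs F m k | ∀ pt : Fin (m + 1) → F, pt ≠ 0 →
            ¬ SingAt F m AB.1 AB.2 fun i => algebraMap F (AlgebraicClosure F) (pt i)} : ℝ) /
          (Nat.card (WPairs F m k) : ℝ))
      atTop
      (nhds ((1 - ((Fintype.card F : ℝ) ^ (m + 1))⁻¹) ^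
        ((Fintype.card F ^ (m + 1) - 1) / (Fintype.card F - 1)))) := by
  have h2 : (2 : F) ≠ 0 := by
    exact_mod_cast (CharP.cast_eq_zero_iff F p 2).not.mpr fun h =>
      absurd (Nat.le_of_dvd two_pos h) (by omega)
  have h3 : (3 : F) ≠ 0 := by
    exact_mod_cast (CharP.cast_eq_zero_iff F p 3).not.mpr fun h =>
      absurd (Nat.le_of_dvd three_pos h) (by omega)
  have hJ : Nat.card (Fin (m + 1) → F) = Fintype.card F ^ (m + 1) := by
    simp [Nat.card_eq_fintype_card]
  have hν : Nat.card (Projectivization F (Fin (m + 1) → F)) =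
      (Fintype.card F ^ (m + 1) - 1) / (Fintype.card F - 1) := by
    rw [Projectivization.card'', hJ, Nat.card_eq_fintype_card]
  refine tendsto_const_nhds.congr' ?_
  filter_upwards [eventually_ge_atTop
    (2 * Nat.card (Projectivization F (Fin (m + 1) → F)) + 1)] with k hk
  have hfin (d : ℕ) : Finite (homogeneousSubmodule (Fin (m + 1)) F d) :=
    have : Module.Finite F (homogeneousSubmodule (Fin (m + 1)) F d) :=
      Module.Finite.iff_fg.mpr (homogeneousSubmodule_fg _ F d)
    Module.finite_of_finite F
  have := hfin (4 * k)
  have := hfin (6 * k)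
  have hker : (Nat.card (jetsHom F m k).ker : ℝ) ≠ 0 := Nat.cast_ne_zero.mpr Nat.card_pos.ne'
  rw [card_smooth_WPairs h2 h3 hk, card_WPairs hk, hJ, ← hν]
  set Q := Fintype.card F ^ (m + 1) with hQ
  have hQpos : 0 < Q := pow_pos Fintype.card_pos _
  have hQ0 : (Q : ℝ) ≠ 0 := Nat.cast_ne_zero.mpr hQpos.ne'
  rw [← Nat.cast_pow, ← hQ]
  push_cast [Nat.cast_sub (Nat.le_mul_of_pos_left Q hQpos)]
  rw [mul_div_mul_right _ _ hker, ← div_pow]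
  congr 1
  field_simp
end
end
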